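/- arXiv:1201.2509 — 10 statements merged into one kernel-verified Lean document; each statement's English description precedes it below -/
import Mathlib

section
/- Let A be a Heyting algebra with involution ∼. Then for all a, b ∈ A: ¬∼(a ⇨ b) ≤ ∼b ⇨ ∼a. -/
/-- In a Heyting algebra with involution, `¬∼(a ⇨ b) ≤ ∼b ⇨ ∼a`. -/
theorem stmt_3 {A : Type*} [HeytingAlgebra A] (inv : A → A)
    (hinv1 : ∀ a b : A, inv (a ⊔ b) = inv a ⊓ inv b)
    (hinv2 : ∀ a : A, inv (inv a) = a) :
    ∀ a b : A, (inv (a ⇨ b))ᶜ ≤ inv b ⇨ inv a := by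
  intro a b
  have h_inf : inv (a ⊓ (a ⇨ b)) = inv a ⊔ inv (a ⇨ b) := by
    rw [← hinv2 (inv a ⊔ inv (a ⇨ b)), hinv1, hinv2, hinv2]
  have h_le : inv b ≤ inv a ⊔ inv (a ⇨ b) := by
    have h := hinv1 (a ⊓ (a ⇨ b)) b
    rw [sup_eq_right.mpr inf_himp_le, h_inf] at h
    exact h.le.trans inf_le_left
  rw [le_himp_iff]
  calc (inv (a ⇨ b))ᶜ ⊓ inv b
      ≤ (inv (a ⇨ b))ᶜ ⊓ (inv a ⊔ inv (a ⇨ b)) := inf_le_inf_left _ h_le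
    _ = (inv (a ⇨ b))ᶜ ⊓ inv a := by rw [inf_sup_left, compl_inf_self, sup_bot_eq]
    _ ≤ inv a := inf_le_right
end

section
/- Let A be a Heyting algebra with involution ∼ and let F be an involutive filter of A. If (a ⇨ b) ⊓ (b ⇨ a) ∈ F for elements a, b ∈ A, then (∼a ⇨ ∼b) ⊓ (∼b ⇨ ∼a) ∈ F. Consequently the relation Θ(F) defined by Θ(F)(a,b) ⟺ (a ⇨ b) ⊓ (b ⇨ a) ∈ F is compatible with the involution ∼. -/
/-- An involutive filter: a filter closed under `a ↦ (inv a)ᶜ`. -/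
def IsInvolutiveFilter {A : Type*} [HeytingAlgebra A] (inv : A → A) (F : Set A) : Prop :=
  (⊤ : A) ∈ F ∧ (∀ a b : A, a ∈ F → b ∈ F → a ⊓ b ∈ F) ∧
  (∀ a b : A, a ∈ F → a ≤ b → b ∈ F) ∧ (∀ a : A, a ∈ F → (inv a)ᶜ ∈ F)

/-- If `c ⊓ a ≤ b`, then `(∼c)ᶜ ≤ ∼b ⇨ ∼a`. -/
theorem compl_inv_le_himp_inv {A : Type*} [HeytingAlgebra A] {inv : A → A}
    (hinv1 : ∀ a b : A, inv (a ⊔ b) = inv a ⊓ inv b)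
    (hinv2 : ∀ a : A, inv (inv a) = a) {a b c : A} (h : c ⊓ a ≤ b) :
    (inv c)ᶜ ≤ inv b ⇨ inv a := by
  have hinf : inv (c ⊓ a) = inv c ⊔ inv a := by
    rw [← hinv2 (inv c ⊔ inv a), hinv1, hinv2, hinv2]
  have hle : inv b ≤ inv c ⊔ inv a := by
    rw [← hinf, ← sup_eq_right.mpr h, hinv1]
    exact inf_le_left
  rw [le_himp_iff]
  calc (inv c)ᶜ ⊓ inv b ≤ (inv c)ᶜ ⊓ (inv c ⊔ inv a) := inf_le_inf_left _ hle
    _ = (inv c)ᶜ ⊓ inv a := by rw [inf_sup_left, compl_inf_self, bot_sup_eq]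
    _ ≤ inv a := inf_le_right

/-- If `F` is an involutive filter and `(a ⇨ b) ⊓ (b ⇨ a) ∈ F`, then
`(∼a ⇨ ∼b) ⊓ (∼b ⇨ ∼a) ∈ F`; i.e. the relation `Θ(F)` is compatible with `∼`. -/
theorem stmt_4 {A : Type*} [HeytingAlgebra A] (inv : A → A)
    (hinv1 : ∀ a b : A, inv (a ⊔ b) = inv a ⊓ inv b)
    (hinv2 : ∀ a : A, inv (inv a) = a)
    (F : Set A) (hF : IsInvolutiveFilter inv F) :
    ∀ a b : A, (a ⇨ b) ⊓ (b ⇨ a) ∈ F → (inv a ⇨ inv b) ⊓ (inv b ⇨ inv a) ∈ F := by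
  intro a b hab
  obtain ⟨-, -, hup, hcompl⟩ := hF
  refine hup _ _ (hcompl _ hab) (le_inf ?_ ?_)
  · exact compl_inv_le_himp_inv hinv1 hinv2 (le_himp_iff.mp inf_le_right)
  · exact compl_inv_le_himp_inv hinv1 hinv2 (le_himp_iff.mp inf_le_left)
end

section
/- Let A be a Heyting algebra with involution ∼ and let B be a nonempty subset of A. Define S to be the set of all a ∈ A such that there exist m ≥ 1, elements a₁, …, a_m ∈ B, and natural numbers n₁, …, n_m with (¬∼)^[n₁](a₁) ⊓ (¬∼)^[n₂](a₂) ⊓ … ⊓ (¬∼)^[n_m](a_m) ≤ a, where (¬∼)^[n] denotes the n-fold iterate of the map x ↦ ¬(∼x). Then S is an involutive filter of A containing B, and S is contained in every involutive filter of A containing B; i.e., S is the involutive filter generated by B. -/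
section InvolutionLemmas

variable {A : Type*} [HeytingAlgebra A] {inv : A → A}

theorem inv_inf_of_involution (hinv1 : ∀ a b : A, inv (a ⊔ b) = inv a ⊓ inv b)
    (hinv2 : ∀ a : A, inv (inv a) = a) (a b : A) : inv (a ⊓ b) = inv a ⊔ inv b := by
  rw [← hinv2 (inv a ⊔ inv b), hinv1, hinv2, hinv2]

theorem inv_top_of_involution (hinv1 : ∀ a b : A, inv (a ⊔ b) = inv a ⊓ inv b)
    (hinv2 : ∀ a : A, inv (inv a) = a) : inv ⊤ = ⊥ := by
  have h := hinv1 ⊤ (inv ⊥)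
  rw [top_sup_eq, hinv2, inf_bot_eq] at h
  exact h

/-- The map `a ↦ (inv a)ᶜ` as a homomorphism of bounded meet-semilattices. -/
def complInvHom (inv : A → A) (hinv1 : ∀ a b : A, inv (a ⊔ b) = inv a ⊓ inv b)
    (hinv2 : ∀ a : A, inv (inv a) = a) : InfTopHom A A where
  toFun x := (inv x)ᶜ
  map_inf' a b := by rw [inv_inf_of_involution hinv1 hinv2, compl_sup]
  map_top' := by rw [inv_top_of_involution hinv1 hinv2, compl_bot]

theorem IsInvolutiveFilter.iterate_mem {F : Set A} (hF : IsInvolutiveFilter inv F)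
    {a : A} (ha : a ∈ F) (n : ℕ) : (fun x => (inv x)ᶜ)^[n] a ∈ F := by
  induction n with
  | zero => exact ha
  | succ n ih =>
    rw [Function.iterate_succ_apply']
    exact hF.2.2.2 _ ih

theorem IsInvolutiveFilter.finset_inf_mem {F : Set A} (hF : IsInvolutiveFilter inv F)
    {ι : Type*} (s : Finset ι) (f : ι → A) (hf : ∀ i ∈ s, f i ∈ F) : s.inf f ∈ F :=
  Finset.inf_induction hF.1 (fun a ha b hb => hF.2.1 a b ha hb) hf

end InvolutionLemmas

/-- The set of elements above some finite meet of iterates `(¬∼)^[nᵢ]` applied to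
elements of `B` is the involutive filter generated by `B`. -/
theorem stmt_6 {A : Type*} [HeytingAlgebra A] (inv : A → A)
    (hinv1 : ∀ a b : A, inv (a ⊔ b) = inv a ⊓ inv b)
    (hinv2 : ∀ a : A, inv (inv a) = a)
    (B : Set A) (hB : B.Nonempty) :
    B ⊆ {a : A | ∃ m : ℕ, 1 ≤ m ∧ ∃ f : Fin m → A, (∀ i, f i ∈ B) ∧
        ∃ n : Fin m → ℕ,
          Finset.univ.inf (fun i => (fun x => (inv x)ᶜ)^[n i] (f i)) ≤ a} ∧
    IsInvolutiveFilter inv {a : A | ∃ m : ℕ, 1 ≤ m ∧ ∃ f : Fin m → A, (∀ i, f i ∈ B) ∧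
        ∃ n : Fin m → ℕ,
          Finset.univ.inf (fun i => (fun x => (inv x)ᶜ)^[n i] (f i)) ≤ a} ∧
    ∀ F : Set A, IsInvolutiveFilter inv F → B ⊆ F →
      {a : A | ∃ m : ℕ, 1 ≤ m ∧ ∃ f : Fin m → A, (∀ i, f i ∈ B) ∧
        ∃ n : Fin m → ℕ,
          Finset.univ.inf (fun i => (fun x => (inv x)ᶜ)^[n i] (f i)) ≤ a} ⊆ F := by
  refine ⟨fun a ha => ⟨1, le_rfl, fun _ => a, fun _ => ha, fun _ => 0, by simp⟩,
    ⟨?_, ?_, ?_, ?_⟩, ?_⟩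
  · obtain ⟨b, hb⟩ := hB
    exact ⟨1, le_rfl, fun _ => b, fun _ => hb, fun _ => 0, le_top⟩
  · rintro a b ⟨m, hm, f, hf, n, ha⟩ ⟨k, -, f', hf', n', hb⟩
    refine ⟨m + k, by omega, Fin.append f f', fun i => ?_, Fin.append n n', le_inf ?_ ?_⟩
    · refine Fin.addCases (fun i => ?_) (fun i => ?_) i
      · simpa using hf i
      · simpa using hf' i
    · refine le_trans (Finset.le_inf fun i _ => ?_) ha
      exact (Finset.inf_le (Finset.mem_univ (Fin.castAdd k i))).trans (by simp)
    · refine le_trans (Finset.le_inf fun i _ => ?_) hb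
      exact (Finset.inf_le (Finset.mem_univ (Fin.natAdd m i))).trans (by simp)
  · rintro a b ⟨m, hm, f, hf, n, ha⟩ hab
    exact ⟨m, hm, f, hf, n, ha.trans hab⟩
  · rintro a ⟨m, hm, f, hf, n, ha⟩
    refine ⟨m, hm, f, hf, fun i => n i + 1, ?_⟩
    simp only [Function.iterate_succ_apply']
    have h := OrderHomClass.mono (complInvHom inv hinv1 hinv2) ha
    rw [map_finset_inf] at h
    exact h
  · rintro F hF hBF a ⟨m, -, f, hf, n, ha⟩
    exact hF.2.2.1 _ _ (hF.finset_inf_mem _ _ fun i _ => hF.iterate_mem (hBF (hf i)) (n i)) ha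
end

section
/- Let A be a finite Heyting algebra with involution ∼. If F and G are involutive filters of A with F ∩ IC(A) = G ∩ IC(A), then F = G. Hence the map F ↦ F ∩ IC(A) from involutive filters of A to subsets of the involutive center is injective. -/
/-- A finite involutive filter has a least element, and it lies in the involutive center. -/
theorem IsInvolutiveFilter.exists_isLeast_compl_eq {A : Type*} [HeytingAlgebra A] {inv : A → A}
    (hinv1 : ∀ a b : A, inv (a ⊔ b) = inv a ⊓ inv b) (hinv2 : ∀ a : A, inv (inv a) = a)
    {F : Set A} (hfin : F.Finite) (hF : IsInvolutiveFilter inv F) :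
    ∃ m, IsLeast F m ∧ mᶜ = inv m := by
  obtain ⟨htop, hinf, -, hinv⟩ := hF
  obtain ⟨m, hm⟩ := hfin.exists_minimal ⟨⊤, htop⟩
  have hleast : ∀ a ∈ F, m ≤ a := fun a ha =>
    (hm.2 (hinf m a hm.1 ha) inf_le_left).trans inf_le_right
  have hdisj : Disjoint m (inv m) := le_compl_iff_disjoint_right.1 (hleast _ (hinv m hm.1))
  have hbot : inv ⊥ = ⊤ := by
    have h := hinv1 (inv ⊤) ⊥
    rw [sup_bot_eq, hinv2, top_inf_eq] at h
    exact h.symm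
  have hsup : m ⊔ inv m = ⊤ := by
    rw [← hinv2 (m ⊔ inv m), hinv1, hinv2, inf_comm, hdisj.eq_bot, hbot]
  exact ⟨m, ⟨hm.1, hleast⟩, IsCompl.compl_eq ⟨hdisj, codisjoint_iff.2 hsup⟩⟩

/-- Inclusion of finite involutive filters can be checked on the involutive center. -/
theorem IsInvolutiveFilter.subset_of_inter_subset {A : Type*} [HeytingAlgebra A] {inv : A → A}
    (hinv1 : ∀ a b : A, inv (a ⊔ b) = inv a ⊓ inv b) (hinv2 : ∀ a : A, inv (inv a) = a)
    {F G : Set A} (hfin : F.Finite) (hF : IsInvolutiveFilter inv F)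
    (hG : IsInvolutiveFilter inv G) (h : F ∩ {a : A | aᶜ = inv a} ⊆ G) : F ⊆ G := by
  obtain ⟨m, hm, hcompl⟩ := hF.exists_isLeast_compl_eq hinv1 hinv2 hfin
  exact fun a ha => hG.2.2.1 m a (h ⟨hm.1, hcompl⟩) (hm.2 ha)

/-- In a finite Heyting algebra with involution, an involutive filter is
determined by its intersection with the involutive center. -/
theorem stmt_9 {A : Type*} [HeytingAlgebra A] [Finite A] (inv : A → A)
    (hinv1 : ∀ a b : A, inv (a ⊔ b) = inv a ⊓ inv b)
    (hinv2 : ∀ a : A, inv (inv a) = a)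
    (F G : Set A) (hF : IsInvolutiveFilter inv F) (hG : IsInvolutiveFilter inv G)
    (h : F ∩ {a : A | aᶜ = inv a} = G ∩ {a : A | aᶜ = inv a}) :
    F = G :=
  (hF.subset_of_inter_subset hinv1 hinv2 F.toFinite hG
    (h.subset.trans Set.inter_subset_left)).antisymm
  (hG.subset_of_inter_subset hinv1 hinv2 G.toFinite hF
    (h.symm.subset.trans Set.inter_subset_left))
end

section
/- Let A be a finite Heyting algebra with involution ∼, and let G ⊆ IC(A) be a filter of the involutive center, i.e., ⊤ ∈ G, G is closed under ⊓, and G is upward closed within IC(A) (if a ∈ G, b ∈ IC(A), and a ≤ b then b ∈ G). Then there exists an involutive filter F of A with F ∩ IC(A) = G. Together with injectivity, the map F ↦ F ∩ IC(A) is a bijection between the involutive filters of A and the filters of the Boolean algebra IC(A). -/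
/-- Every filter of the involutive center of a finite Heyting algebra with
involution is the trace of an involutive filter of the whole algebra
(surjectivity of `F ↦ F ∩ IC(A)`). -/
theorem stmt_10 {A : Type*} [HeytingAlgebra A] [Finite A] (inv : A → A)
    (hinv1 : ∀ a b : A, inv (a ⊔ b) = inv a ⊓ inv b)
    (hinv2 : ∀ a : A, inv (inv a) = a)
    (G : Set A) (hGsub : G ⊆ {a : A | aᶜ = inv a})
    (hGtop : (⊤ : A) ∈ G)
    (hGinf : ∀ a b : A, a ∈ G → b ∈ G → a ⊓ b ∈ G)
    (hGup : ∀ a b : A, a ∈ G → b ∈ {a : A | aᶜ = inv a} → a ≤ b → b ∈ G) :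
    ∃ F : Set A, IsInvolutiveFilter inv F ∧ F ∩ {a : A | aᶜ = inv a} = G := by
  have hanti : ∀ a b : A, a ≤ b → inv b ≤ inv a := fun a b hab => by
    rw [← sup_eq_right.mpr hab, hinv1]
    exact inf_le_left
  refine ⟨{a : A | ∃ g ∈ G, g ≤ a}, ⟨⟨⊤, hGtop, le_rfl⟩, ?_, ?_, ?_⟩, ?_⟩
  · rintro a b ⟨g, hg, hga⟩ ⟨h, hh, hhb⟩
    exact ⟨g ⊓ h, hGinf g h hg hh, inf_le_inf hga hhb⟩
  · rintro a b ⟨g, hg, hga⟩ hab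
    exact ⟨g, hg, hga.trans hab⟩
  · rintro a ⟨g, hg, hga⟩
    have hgc : gᶜ = inv g := hGsub hg
    refine ⟨g, hg, le_compl_compl.trans (compl_le_compl ?_)⟩
    rw [hgc]
    exact hanti g a hga
  · ext a
    constructor
    · rintro ⟨⟨g, hg, hga⟩, ha⟩
      exact hGup g a hg ha hga
    · exact fun ha => ⟨⟨a, ha, le_rfl⟩, hGsub ha⟩
end

section
/- Let A be a finite nontrivial Heyting algebra with involution ∼. Then the following are equivalent: (1) there exists an involutive filter F₀ ≠ {⊤} of A such that F₀ is contained in every involutive filter G ≠ {⊤} of A (i.e., A is subdirectly irreducible); (2) there is no a ∈ A with a ≠ ⊥, a ≠ ⊤, and ¬a = ∼a (i.e., IC(A) = {⊥, ⊤}). -/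
section Involution

variable {A : Type*} [HeytingAlgebra A] {inv : A → A}

theorem antitone_of_map_sup (hsup : ∀ a b : A, inv (a ⊔ b) = inv a ⊓ inv b) : Antitone inv := by
  intro a b h
  rw [← sup_eq_right.mpr h, hsup]
  exact inf_le_left

theorem involution_top (hsup : ∀ a b : A, inv (a ⊔ b) = inv a ⊓ inv b)
    (hinv : ∀ a : A, inv (inv a) = a) : inv ⊤ = ⊥ :=
  le_bot_iff.mp (by simpa [hinv] using antitone_of_map_sup hsup (le_top (a := inv ⊥)))

theorem involution_bot (hsup : ∀ a b : A, inv (a ⊔ b) = inv a ⊓ inv b)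
    (hinv : ∀ a : A, inv (inv a) = a) : inv ⊥ = ⊤ := by
  rw [← involution_top hsup hinv, hinv]

/-- If `a` and `inv a` are disjoint, then they are complements. -/
theorem isCompl_involution (hsup : ∀ a b : A, inv (a ⊔ b) = inv a ⊓ inv b)
    (hinv : ∀ a : A, inv (inv a) = a) {a : A} (h : Disjoint a (inv a)) : IsCompl a (inv a) := by
  refine ⟨h, codisjoint_iff.mpr ?_⟩
  rw [← hinv (a ⊔ inv a), hsup, hinv, h.symm.eq_bot, involution_bot hsup hinv]

theorem isInvolutiveFilter_Ici (hsup : ∀ a b : A, inv (a ⊔ b) = inv a ⊓ inv b) {a : A}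
    (h : Disjoint a (inv a)) : IsInvolutiveFilter inv (Set.Ici a) :=
  ⟨le_top, fun _ _ => le_inf, fun _ _ => le_trans, fun _ hb =>
    le_compl_iff_disjoint_right.mpr (h.mono_right (antitone_of_map_sup hsup hb))⟩

/-- An involutive filter of a finite algebra has a least element, disjoint from its involute. -/
theorem IsInvolutiveFilter.exists_isLeast [Finite A] {G : Set A} (hG : IsInvolutiveFilter inv G) :
    ∃ m, IsLeast G m ∧ Disjoint m (inv m) := by
  obtain ⟨htop, hinf, -, hcl⟩ := hG
  obtain ⟨m, hm⟩ := G.toFinite.exists_minimal ⟨⊤, htop⟩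
  have hle : ∀ x ∈ G, m ≤ x := fun x hx =>
    (hm.le_of_le (hinf m x hm.prop hx) inf_le_left).trans inf_le_right
  exact ⟨m, ⟨hm.prop, hle⟩, le_compl_iff_disjoint_right.mp (hle _ (hcl m hm.prop))⟩

end Involution

/-- A finite nontrivial Heyting algebra with involution is subdirectly
irreducible (there is a smallest nontrivial involutive filter) iff its
involutive center is `{⊥, ⊤}`. -/
theorem stmt_11 {A : Type*} [HeytingAlgebra A] [Finite A] (inv : A → A)
    (hinv1 : ∀ a b : A, inv (a ⊔ b) = inv a ⊓ inv b)
    (hinv2 : ∀ a : A, inv (inv a) = a)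
    (hnontriv : (⊥ : A) ≠ ⊤) :
    (∃ F₀ : Set A, IsInvolutiveFilter inv F₀ ∧ F₀ ≠ {(⊤ : A)} ∧
        ∀ G : Set A, IsInvolutiveFilter inv G → G ≠ {(⊤ : A)} → F₀ ⊆ G) ↔
      ¬ ∃ a : A, a ≠ ⊥ ∧ a ≠ ⊤ ∧ aᶜ = inv a := by
  constructor
  · rintro ⟨F, hF, hne, hmin⟩ ⟨a, hbot, htop, ha⟩
    have hd : Disjoint a (inv a) := ha ▸ disjoint_compl_right
    have hc := isCompl_involution hinv1 hinv2 hd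
    have hd' : Disjoint (inv a) (inv (inv a)) := by rw [hinv2]; exact hd.symm
    have ne_of {b : A} (hb : b ≠ ⊤) : Set.Ici b ≠ {⊤} := fun h =>
      hb (h.subset (Set.self_mem_Ici (a := b)))
    have htop' : inv a ≠ ⊤ := fun h => hbot (by rw [← hinv2 a, h, involution_top hinv1 hinv2])
    refine hne (Set.eq_singleton_iff_unique_mem.mpr ⟨hF.1, fun x hx => ?_⟩)
    have h₁ : a ≤ x := hmin _ (isInvolutiveFilter_Ici hinv1 hd) (ne_of htop) hx
    have h₂ : inv a ≤ x := hmin _ (isInvolutiveFilter_Ici hinv1 hd') (ne_of htop') hx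
    exact top_le_iff.mp (hc.sup_eq_top ▸ sup_le h₁ h₂)
  · intro h
    refine ⟨Set.univ, ⟨trivial, fun _ _ _ _ => trivial, fun _ _ _ _ => trivial,
      fun _ _ => trivial⟩, fun hu => hnontriv (hu.subset (Set.mem_univ ⊥)), fun G hG hne x _ => ?_⟩
    obtain ⟨m, ⟨hm, hle⟩, hd⟩ := hG.exists_isLeast
    have hmtop : m ≠ ⊤ := by
      rintro rfl
      exact hne (Set.eq_singleton_iff_unique_mem.mpr ⟨hm, fun y hy => top_le_iff.mp (hle hy)⟩)
    have hmbot : m = ⊥ := by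
      by_contra hb
      exact h ⟨m, hb, hmtop, (isCompl_involution hinv1 hinv2 hd).compl_eq⟩
    exact hG.2.2.1 m x hm (hmbot ▸ bot_le)
end

section
/- Let A be a Heyting algebra with involution ∼ such that no element a ∈ A satisfies a ≠ ⊥, a ≠ ⊤, and ¬a = ∼a. Then for every a ∈ A with a ≠ ⊥ and a ≠ ⊤ one has a ⊓ ¬∼a < a (strict inequality). -/
/-- If the involutive center of a Heyting algebra with involution is trivial,
then `a ⊓ ¬∼a < a` for every `a` different from `⊥` and `⊤`. -/
theorem stmt_12 {A : Type*} [HeytingAlgebra A] (inv : A → A)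
    (hinv1 : ∀ a b : A, inv (a ⊔ b) = inv a ⊓ inv b)
    (hinv2 : ∀ a : A, inv (inv a) = a)
    (hIC : ¬ ∃ a : A, a ≠ ⊥ ∧ a ≠ ⊤ ∧ aᶜ = inv a) :
    ∀ a : A, a ≠ ⊥ → a ≠ ⊤ → a ⊓ (inv a)ᶜ < a := by
  intro a ha_bot ha_top
  refine lt_of_le_of_ne inf_le_left fun h => hIC ⟨a, ha_bot, ha_top, ?_⟩
  have hdisj : a ⊓ inv a = ⊥ :=
    (le_compl_iff_disjoint_right.mp (inf_eq_left.mp h)).eq_bot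
  have hbot : inv ⊥ = ⊤ := by
    have h_top := hinv1 ⊥ (inv ⊤)
    rw [bot_sup_eq, hinv2, inf_top_eq] at h_top
    exact h_top.symm
  have hcodisj : a ⊔ inv a = ⊤ := by
    rw [← hinv2 (a ⊔ inv a), hinv1, hinv2, inf_comm, hdisj, hbot]
  exact (IsCompl.of_eq hdisj hcodisj).compl_eq
end

section
/- Let A be a finite Heyting algebra with involution ∼ such that no element a ∈ A satisfies a ≠ ⊥, a ≠ ⊤, and ¬a = ∼a. Let k₁ : A → A be the map k₁(x) = x ⊓ ¬∼x. Then there exists a natural number n ≥ 1 such that the n-fold iterate k₁^[n] satisfies: k₁^[n](a) = ⊥ for every a ≠ ⊤, and k₁^[n](⊤) = ⊤. That is, A admits a killer function obtained by iterating x ↦ x ⊓ ¬∼x. -/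
section
variable {A : Type*} [HeytingAlgebra A] {inv : A → A}

theorem inv_bot_of_involution (hinv1 : ∀ a b : A, inv (a ⊔ b) = inv a ⊓ inv b)
    (hinv2 : ∀ a : A, inv (inv a) = a) : inv ⊥ = ⊤ := by
  have h := hinv1 (inv ⊤) ⊥
  rw [sup_bot_eq, hinv2, top_inf_eq] at h
  exact h.symm

theorem compl_eq_inv_of_inf_eq_self (hinv1 : ∀ a b : A, inv (a ⊔ b) = inv a ⊓ inv b)
    (hinv2 : ∀ a : A, inv (inv a) = a) {x : A} (hx : x ⊓ (inv x)ᶜ = x) : xᶜ = inv x := by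
  have hdisj : Disjoint x (inv x) := le_compl_iff_disjoint_right.1 (inf_eq_left.1 hx)
  have hsup : x ⊔ inv x = ⊤ := by
    rw [← hinv2 (x ⊔ inv x), hinv1, hinv2, hdisj.symm.eq_bot, inv_bot_of_involution hinv1 hinv2]
  exact (IsCompl.of_eq hdisj.eq_bot hsup).compl_eq

end

/-- A pointwise deflationary self-map of a finite partial order has an iterate whose values are
fixed points. -/
theorem exists_iterate_fixed {α : Type*} [PartialOrder α] [Finite α] {f : α → α}
    (hf : ∀ x, f x ≤ x) : ∃ n : ℕ, 1 ≤ n ∧ ∀ a, f (f^[n] a) = f^[n] a := by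
  have hanti : Antitone fun n : ℕ => f^[n] := antitone_nat_of_succ_le fun n a => by
    simpa only [Function.iterate_succ_apply'] using hf _
  obtain ⟨n, hn⟩ := WellFoundedGT.monotone_chain_condition
    (⟨fun n => OrderDual.toDual f^[n], fun _ _ h => hanti h⟩ : ℕ →o (α → α)ᵒᵈ)
  have hstab : ∀ m, n ≤ m → f^[n] = f^[m] := hn
  refine ⟨n + 1, by omega, fun a => ?_⟩
  rw [← Function.iterate_succ_apply' f, ← hstab (n + 1) (by omega), ← hstab (n + 2) (by omega)]

/-- In a finite Heyting algebra with involution with trivial involutive center,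
some iterate of `x ↦ x ⊓ ¬∼x` is a killer function. -/
theorem stmt_13 {A : Type*} [HeytingAlgebra A] [Finite A] (inv : A → A)
    (hinv1 : ∀ a b : A, inv (a ⊔ b) = inv a ⊓ inv b)
    (hinv2 : ∀ a : A, inv (inv a) = a)
    (hIC : ¬ ∃ a : A, a ≠ ⊥ ∧ a ≠ ⊤ ∧ aᶜ = inv a) :
    ∃ n : ℕ, 1 ≤ n ∧
      (∀ a : A, a ≠ ⊤ → (fun x => x ⊓ (inv x)ᶜ)^[n] a = ⊥) ∧
      (fun x => x ⊓ (inv x)ᶜ)^[n] (⊤ : A) = ⊤ := by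
  have hle : ∀ x : A, (fun x => x ⊓ (inv x)ᶜ) x ≤ x := fun _ => inf_le_left
  obtain ⟨n, hn, hfix⟩ := exists_iterate_fixed hle
  refine ⟨n, hn, fun a ha => ?_, Function.iterate_fixed ?_ n⟩
  · by_contra hbot
    refine hIC ⟨_, hbot, fun htop => ha (top_le_iff.1 ?_),
      compl_eq_inv_of_inf_eq_self hinv1 hinv2 (hfix a)⟩
    exact htop.ge.trans (Function.iterate_le_id_of_le_id hle n a)
  · have htop : inv ⊤ = ⊥ := by rw [← inv_bot_of_involution hinv1 hinv2, hinv2]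
    simp [htop]
end

section
/- Let A be a Heyting algebra with involution ∼ and suppose k : A → A is a killer on A, i.e., k(a) = ⊥ for a ≠ ⊤ and k(⊤) = ⊤. Define t : A³ → A by t(x,y,z) = (k((x ⇨ y) ⊓ (y ⇨ x)) ⊓ z) ⊔ (∼k((x ⇨ y) ⊓ (y ⇨ x)) ⊓ x). Then t is the discriminator function on A: for all a, b, c ∈ A, t(a,b,c) = c if a = b, and t(a,b,c) = a if a ≠ b. -/
/-- From a killer function `k` one obtains the discriminator function
`t(x,y,z) = (k((x ⇨ y) ⊓ (y ⇨ x)) ⊓ z) ⊔ (∼k((x ⇨ y) ⊓ (y ⇨ x)) ⊓ x)`. -/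
theorem stmt_14 {A : Type*} [HeytingAlgebra A] (inv : A → A)
    (hinv1 : ∀ a b : A, inv (a ⊔ b) = inv a ⊓ inv b)
    (hinv2 : ∀ a : A, inv (inv a) = a)
    (k : A → A) (hk1 : ∀ a : A, a ≠ ⊤ → k a = ⊥) (hk2 : k ⊤ = ⊤) :
    ∀ a b c : A,
      (a = b →
        (k ((a ⇨ b) ⊓ (b ⇨ a)) ⊓ c) ⊔ (inv (k ((a ⇨ b) ⊓ (b ⇨ a))) ⊓ a) = c) ∧
      (a ≠ b →
        (k ((a ⇨ b) ⊓ (b ⇨ a)) ⊓ c) ⊔ (inv (k ((a ⇨ b) ⊓ (b ⇨ a))) ⊓ a) = a) := by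
  have inv_bot : inv ⊥ = ⊤ := by
    have h := hinv1 ⊥ (inv ⊤)
    rw [bot_sup_eq, hinv2, inf_top_eq] at h
    exact h.symm
  have inv_top : inv ⊤ = ⊥ := by rw [← inv_bot, hinv2]
  intro a b c
  refine ⟨?_, fun hab => ?_⟩
  · rintro rfl
    rw [himp_self, inf_top_eq, hk2, inv_top, top_inf_eq, bot_inf_eq, sup_bot_eq]
  · have hne : (a ⇨ b) ⊓ (b ⇨ a) ≠ ⊤ := by
      rw [Ne, inf_eq_top_iff, himp_eq_top_iff, himp_eq_top_iff]
      exact fun h => hab (le_antisymm h.1 h.2)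
    rw [hk1 _ hne, inv_bot, bot_inf_eq, top_inf_eq, bot_sup_eq]
end

section
/- Let A be a finite nontrivial Heyting algebra with involution ∼ such that no element a ∈ A satisfies a ≠ ⊥, a ≠ ⊤, and ¬a = ∼a (i.e., A is subdirectly irreducible). Then there exists a natural number n ≥ 1 such that, with k = (x ↦ x ⊓ ¬∼x)^[n] (the n-fold iterate), the function t(x,y,z) = (k((x ⇨ y) ⊓ (y ⇨ x)) ⊓ z) ⊔ (∼k((x ⇨ y) ⊓ (y ⇨ x)) ⊓ x) is the discriminator function on A: for all a, b, c ∈ A, t(a,b,c) = c if a = b and t(a,b,c) = a if a ≠ b. In particular, A is quasi-primal. -/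
/-- On a finite partial order, the iterates of a map `f` with `f x ≤ x` become stationary,
uniformly in the argument. -/
theorem exists_iterate_succ_eq_of_le_id {α : Type*} [PartialOrder α] [Finite α] {f : α → α}
    (hf : ∀ x, f x ≤ x) : ∃ n : ℕ, 1 ≤ n ∧ ∀ x, f (f^[n] x) = f^[n] x := by
  have hanti : Antitone fun n : ℕ => f^[n] :=
    antitone_nat_of_succ_le fun n x => by
      simpa only [Function.iterate_succ_apply'] using hf (f^[n] x)
  obtain ⟨m, k, hmk, heq⟩ : ∃ m k : ℕ, m < k ∧ f^[m] = f^[k] := by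
    obtain ⟨m, k, hne, heq⟩ := Finite.exists_ne_map_eq_of_infinite fun n : ℕ => f^[n]
    rcases hne.lt_or_gt with h | h
    · exact ⟨m, k, h, heq⟩
    · exact ⟨k, m, h, heq.symm⟩
  have hfix : ∀ x, f (f^[m] x) = f^[m] x := fun x => by
    refine le_antisymm (hf _) ?_
    calc f^[m] x = f^[k] x := congrFun heq x
      _ ≤ f^[m + 1] x := hanti (Nat.succ_le_of_lt hmk) x
      _ = f (f^[m] x) := Function.iterate_succ_apply' f m x
  refine ⟨m + 1, Nat.le_add_left 1 m, fun x => ?_⟩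
  rw [Function.iterate_succ_apply', hfix, hfix]

/-- In a Heyting algebra with involution, a fixed point of `x ↦ x ⊓ (inv x)ᶜ` is complemented,
with complement `inv x`. -/
theorem compl_eq_involution_of_inf_compl_eq {A : Type*} [HeytingAlgebra A] {inv : A → A}
    (hinv1 : ∀ a b : A, inv (a ⊔ b) = inv a ⊓ inv b) (hinv2 : ∀ a : A, inv (inv a) = a)
    (hbot : inv ⊥ = ⊤) {x : A} (hx : x ⊓ (inv x)ᶜ = x) : xᶜ = inv x := by
  have hdisj : x ⊓ inv x = ⊥ := (le_compl_iff_disjoint_right.1 (inf_eq_left.1 hx)).eq_bot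
  have hsup : x ⊔ inv x = ⊤ := by
    rw [← hinv2 (x ⊔ inv x), hinv1, hinv2, inf_comm, hdisj, hbot]
  exact (IsCompl.of_eq hdisj hsup).compl_eq


/-- A finite nontrivial subdirectly irreducible Heyting algebra with involution
is quasi-primal: with `k` a suitable iterate of `x ↦ x ⊓ ¬∼x`, the term
`t(x,y,z) = (k((x ⇨ y) ⊓ (y ⇨ x)) ⊓ z) ⊔ (∼k((x ⇨ y) ⊓ (y ⇨ x)) ⊓ x)`
represents the discriminator function. -/
theorem stmt_16 {A : Type*} [HeytingAlgebra A] [Finite A] (inv : A → A)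
    (hinv1 : ∀ a b : A, inv (a ⊔ b) = inv a ⊓ inv b)
    (hinv2 : ∀ a : A, inv (inv a) = a)
    (hnontriv : (⊥ : A) ≠ ⊤)
    (hIC : ¬ ∃ a : A, a ≠ ⊥ ∧ a ≠ ⊤ ∧ aᶜ = inv a) :
    ∃ n : ℕ, 1 ≤ n ∧
      ∀ a b c : A,
        (a = b →
          ((fun x => x ⊓ (inv x)ᶜ)^[n] ((a ⇨ b) ⊓ (b ⇨ a)) ⊓ c) ⊔
            (inv ((fun x => x ⊓ (inv x)ᶜ)^[n] ((a ⇨ b) ⊓ (b ⇨ a))) ⊓ a) = c) ∧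
        (a ≠ b →
          ((fun x => x ⊓ (inv x)ᶜ)^[n] ((a ⇨ b) ⊓ (b ⇨ a)) ⊓ c) ⊔
            (inv ((fun x => x ⊓ (inv x)ᶜ)^[n] ((a ⇨ b) ⊓ (b ⇨ a))) ⊓ a) = a) := by
  have hbot : inv ⊥ = ⊤ := by
    have h := hinv1 ⊥ (inv ⊤)
    rw [bot_sup_eq, hinv2, inf_top_eq] at h
    exact h.symm
  have htop : inv ⊤ = ⊥ := by rw [← hbot, hinv2]
  obtain ⟨n, hn, hfix⟩ := exists_iterate_succ_eq_of_le_id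
    (f := fun x : A => x ⊓ (inv x)ᶜ) fun _ => inf_le_left
  have hle : ∀ x : A, (fun x => x ⊓ (inv x)ᶜ)^[n] x ≤ x := fun x =>
    Function.iterate_le_id_of_le_id (f := fun x : A => x ⊓ (inv x)ᶜ) (fun _ => inf_le_left) n x
  refine ⟨n, hn, fun a b c => ⟨?_, fun hab => ?_⟩⟩
  · rintro rfl
    have hk : (fun x : A => x ⊓ (inv x)ᶜ)^[n] ⊤ = ⊤ :=
      Function.iterate_fixed (by simp [htop]) n
    simp [hk, htop]
  · have hk : (fun x : A => x ⊓ (inv x)ᶜ)^[n] ((a ⇨ b) ⊓ (b ⇨ a)) = ⊥ := by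
      by_contra hne
      refine hIC ⟨_, hne, fun h => hab ?_,
        compl_eq_involution_of_inf_compl_eq hinv1 hinv2 hbot (hfix _)⟩
      have h1 : (a ⇨ b) ⊓ (b ⇨ a) = ⊤ := top_le_iff.1 (h ▸ hle _)
      rw [inf_eq_top_iff, himp_eq_top_iff, himp_eq_top_iff] at h1
      exact le_antisymm h1.1 h1.2
    simp [hk, hbot]
end
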